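/- arXiv:1807.01951 — 2 statements merged into one kernel-verified Lean document; each statement's English description precedes it below -/
import Mathlib

section
/- Let G be a group satisfying the Tits alternative in the following sense: every finitely generated subgroup H of G either contains a free group on two generators (there is an injective group homomorphism from FreeGroup (Fin 2) into H) or is virtually solvable. Then every subgroup of G is finitely generated (equivalently, G satisfies the maximal condition on subgroups) if and only if G is virtually polycyclic. -/
/-- A group is polycyclic if it has a finite subnormal chain `⊥ = G₀ ≤ ⋯ ≤ Gₙ = ⊤`
with each `Gᵢ` normal in `Gᵢ₊₁` and each quotient `Gᵢ₊₁/Gᵢ` cyclic. -/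
def IsPolycyclic (G : Type*) [Group G] : Prop :=
  ∃ (n : ℕ) (s : Fin (n + 1) → Subgroup G),
    s 0 = ⊥ ∧ s (Fin.last n) = ⊤ ∧
    ∀ i : Fin n,
      s i.castSucc ≤ s i.succ ∧
      ∃ hn : ((s i.castSucc).subgroupOf (s i.succ)).Normal,
        letI := hn
        IsCyclic ((s i.succ) ⧸ (s i.castSucc).subgroupOf (s i.succ))

namespace Subgroup

variable {A B : Type*} [Group A] [Group B]

theorem fg_of_fg_map_injective {f : A →* B} (hf : Function.Injective f) {K : Subgroup A}
    (h : (K.map f).FG) : K.FG := by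
  rw [Subgroup.fg_iff_submonoid_fg] at h ⊢
  exact Submonoid.FG.map_injective f hf h

theorem FG.map_hom {K : Subgroup A} (h : K.FG) (f : A →* B) : (K.map f).FG := by
  rw [Subgroup.fg_iff_submonoid_fg] at h ⊢
  exact Submonoid.FG.map h f

/-- Finite generation is closed under extensions. -/
theorem fg_of_fg_inf_ker_of_fg_map (f : A →* B) {K : Subgroup A}
    (h₁ : (K ⊓ f.ker).FG) (h₂ : (K.map f).FG) : K.FG := by
  obtain ⟨S, hS, hfin⟩ := (Subgroup.fg_iff _).1 h₂
  have hSK : S ⊆ f '' K := by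
    rw [← Subgroup.coe_map, ← hS]
    exact Subgroup.subset_closure
  obtain ⟨T, hTK, hTS⟩ := Set.SurjOn.exists_bijOn_subset hSK
  have hT : T.Finite := hTS.finite_iff_finite.2 hfin
  have hTcl : Subgroup.closure T ≤ K := (Subgroup.closure_le K).2 hTK
  have hK : K = (K ⊓ f.ker) ⊔ Subgroup.closure T := by
    apply le_antisymm _ (sup_le inf_le_left hTcl)
    intro x hx
    have hfx : f x ∈ (Subgroup.closure T).map f := by
      rw [MonoidHom.map_closure, hTS.image_eq, hS]
      exact Subgroup.mem_map_of_mem f hx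
    obtain ⟨y, hy, hyx⟩ := hfx
    have hxy : x * y⁻¹ ∈ K ⊓ f.ker :=
      ⟨K.mul_mem hx (K.inv_mem (hTcl hy)), by simp [hyx]⟩
    simpa using Subgroup.mul_mem_sup hxy hy
  rw [hK]
  exact h₁.sup ((Subgroup.fg_iff _).2 ⟨T, rfl, hT⟩)

theorem fg_of_isCyclic [IsCyclic A] (K : Subgroup A) : K.FG := by
  obtain ⟨g, hg⟩ := (Subgroup.isCyclic_iff_exists_zpowers_eq_top K).1 inferInstance
  rw [← hg, zpowers_eq_closure]
  exact (Subgroup.fg_iff _).2 ⟨{g}, rfl, Set.finite_singleton g⟩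

theorem fg_of_finiteIndex {H : Subgroup A} [H.FiniteIndex]
    (hH : ∀ K ≤ H, K.FG) (K : Subgroup A) : K.FG := by
  refine fg_of_fg_inf_ker_of_fg_map (QuotientGroup.mk' H.normalCore) (hH _ ?_) ?_
  · rw [QuotientGroup.ker_mk']
    exact inf_le_right.trans H.normalCore_le
  · rw [← Group.fg_iff_subgroup_fg]
    infer_instance

/-- `C` is a normal subgroup of `D` with cyclic quotient. -/
def IsCyclicStep (C D : Subgroup A) : Prop :=
  C ≤ D ∧ ∃ hn : (C.subgroupOf D).Normal,
    letI := hn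
    IsCyclic (D ⧸ C.subgroupOf D)

theorem IsCyclicStep.fg {C D : Subgroup A} (h : IsCyclicStep C D)
    (hC : ∀ K ≤ C, K.FG) (K : Subgroup A) (hK : K ≤ D) : K.FG := by
  obtain ⟨-, hn, hc⟩ := h
  have key : (K.subgroupOf D).FG := by
    refine fg_of_fg_inf_ker_of_fg_map (QuotientGroup.mk' (C.subgroupOf D)) ?_ (fg_of_isCyclic _)
    refine fg_of_fg_map_injective D.subtype_injective (hC _ ?_)
    rw [QuotientGroup.ker_mk']
    refine (Subgroup.map_mono inf_le_right).trans ?_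
    rw [Subgroup.subgroupOf_map_subtype]
    exact inf_le_left
  have := key.map_hom D.subtype
  rwa [Subgroup.map_subgroupOf_eq_of_le hK] at this

theorem isCyclicStep_sup_zpowers {C D : Subgroup A} (hCD : C ≤ D) (hcomm : ⁅D, D⁆ ≤ C)
    {t : A} (ht : t ∈ D) : IsCyclicStep C (C ⊔ zpowers t) := by
  have hE : C ⊔ zpowers t ≤ D := sup_le hCD (by simpa using ht)
  have hn : (C.subgroupOf (C ⊔ zpowers t)).Normal := by
    refine ⟨fun c hc g => ?_⟩
    rw [mem_subgroupOf] at hc ⊢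
    have := C.mul_mem (hcomm (commutator_mem_commutator (hE g.2) (hE c.2))) hc
    simpa [commutatorElement_def] using this
  refine ⟨le_sup_left, hn, ?_⟩
  have htE : t ∈ C ⊔ zpowers t := mem_sup_right (mem_zpowers t)
  let q := QuotientGroup.mk' (C.subgroupOf (C ⊔ zpowers t))
  refine ⟨q ⟨t, htE⟩, fun x => ?_⟩
  obtain ⟨x, rfl⟩ := QuotientGroup.mk'_surjective _ x
  have hle : C ⊔ zpowers t ≤
      ((zpowers (q ⟨t, htE⟩)).comap q).map (C ⊔ zpowers t).subtype := by
    refine sup_le (fun c hc => ⟨⟨c, mem_sup_left hc⟩, ?_, rfl⟩) ?_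
    · have : q ⟨c, mem_sup_left hc⟩ = 1 := (QuotientGroup.eq_one_iff _).2 hc
      change q _ ∈ zpowers (q ⟨t, htE⟩)
      rw [this]
      exact one_mem _
    · rw [zpowers_le]
      exact ⟨⟨t, htE⟩, mem_zpowers _, rfl⟩
  obtain ⟨y, hy, hyx⟩ := hle x.2
  obtain rfl : y = x := Subtype.ext hyx
  exact hy

theorem reflTransGen_isCyclicStep_of_commutator_le {C D : Subgroup A} (hCD : C ≤ D)
    (hcomm : ⁅D, D⁆ ≤ C) (hD : D.FG) : Relation.ReflTransGen IsCyclicStep C D := by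
  obtain ⟨S, rfl⟩ := hD
  suffices h : ∀ T : Finset A, T ⊆ S →
      Relation.ReflTransGen IsCyclicStep C (C ⊔ closure (T : Set A)) by
    simpa [sup_eq_right.2 hCD] using h S subset_rfl
  classical
  intro T
  induction T using Finset.induction_on with
  | empty => intro _; simpa using Relation.ReflTransGen.refl
  | insert t T _ ih =>
    intro hT
    have hTS : T ⊆ S := (Finset.subset_insert t T).trans hT
    refine (ih hTS).tail ?_
    have heq : C ⊔ closure ((insert t T : Finset A) : Set A) =
        (C ⊔ closure (T : Set A)) ⊔ zpowers t := by
      rw [Finset.coe_insert, Set.insert_eq, closure_union, ← zpowers_eq_closure,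
        sup_comm (zpowers t), sup_assoc]
    rw [heq]
    exact isCyclicStep_sup_zpowers (sup_le hCD (closure_mono (by exact_mod_cast hTS)))
      (hcomm.trans le_sup_left) (subset_closure (hT (Finset.mem_insert_self t T)))

end Subgroup

open Subgroup

theorem IsPolycyclic.subgroup_fg {A : Type*} [Group A] (h : IsPolycyclic A) (K : Subgroup A) :
    K.FG := by
  obtain ⟨n, s, h0, hlast, hs⟩ := h
  have key : ∀ i, ∀ K ≤ s i, K.FG := by
    intro i
    induction i using Fin.induction with
    | zero =>
      intro K hK
      rw [h0, le_bot_iff] at hK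
      exact hK ▸ Subgroup.FG.bot
    | succ i ih => exact IsCyclicStep.fg (hs i) ih
  exact key (Fin.last n) K (hlast ▸ le_top)

theorem isPolycyclic_of_reflTransGen {A : Type*} [Group A]
    (h : Relation.ReflTransGen IsCyclicStep (⊥ : Subgroup A) ⊤) : IsPolycyclic A := by
  suffices key : ∀ D : Subgroup A, Relation.ReflTransGen IsCyclicStep ⊥ D →
      ∃ (n : ℕ) (s : Fin (n + 1) → Subgroup A), s 0 = ⊥ ∧ s (Fin.last n) = D ∧
        ∀ i : Fin n, IsCyclicStep (s i.castSucc) (s i.succ) from key ⊤ h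
  intro D hD
  induction hD with
  | refl => exact ⟨0, fun _ => ⊥, rfl, rfl, fun i => i.elim0⟩
  | @tail C D _ hCD ih =>
    obtain ⟨n, s, h0, hlast, hs⟩ := ih
    refine ⟨n + 1, Fin.snoc (α := fun _ => Subgroup A) s D, ?_, by simp, fun i => ?_⟩
    · rw [← Fin.castSucc_zero, Fin.snoc_castSucc, h0]
    · induction i using Fin.lastCases with
      | last => simpa [hlast] using hCD
      | cast i =>
        rw [Fin.snoc_castSucc, Fin.succ_castSucc, Fin.snoc_castSucc]
        exact hs i

theorem isPolycyclic_of_isSolvable {A : Type*} [Group A] [Group.IsSolvable A]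
    (hA : ∀ K : Subgroup A, K.FG) : IsPolycyclic A := by
  obtain ⟨n, hn⟩ := (Group.isSolvable_def A).1 inferInstance
  apply isPolycyclic_of_reflTransGen
  rw [← hn]
  clear hn
  induction n with
  | zero => exact Relation.ReflTransGen.refl
  | succ n ih =>
    exact (reflTransGen_isCyclicStep_of_commutator_le
      (derivedSeries_antitone A n.le_succ) le_rfl (hA _)).trans ih

/-- The subgroup of `Equiv.Perm ℤ` generated by all transpositions of adjacent integers is
not finitely generated. -/
theorem not_fg_closure_swap_add_one :
    ¬ (closure (Set.range fun n : ℤ => Equiv.swap n (n + 1))).FG := by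
  have hfix : ∀ σ ∈ closure (Set.range fun n : ℤ => Equiv.swap n (n + 1)),
      ∀ᶠ k in Filter.atTop, σ k = k := by
    intro σ hσ
    induction hσ using closure_induction with
    | mem σ hσ =>
      obtain ⟨n, rfl⟩ := hσ
      filter_upwards [Filter.eventually_gt_atTop (n + 1)] with k hk
      exact Equiv.swap_apply_of_ne_of_ne (by lia) (by lia)
    | one => simp
    | mul σ τ _ _ hσ hτ =>
      filter_upwards [hσ, hτ] with k h₁ h₂
      rw [Equiv.Perm.mul_apply, h₂, h₁]
    | inv σ _ hσ =>
      filter_upwards [hσ] with k hk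
      rw [Equiv.Perm.inv_eq_iff_eq, hk]
  intro hfg
  obtain ⟨S, hS, hfin⟩ := (Subgroup.fg_iff _).1 hfg
  have hall : ∀ᶠ k : ℤ in Filter.atTop, ∀ σ ∈ S, σ k = k :=
    (Filter.eventually_all_finite hfin).2 fun σ hσ => hfix σ (hS ▸ subset_closure hσ)
  obtain ⟨k, hk⟩ := hall.exists
  have hle : closure S ≤ MulAction.stabilizer (Equiv.Perm ℤ) k :=
    (closure_le _).2 fun σ hσ => hk σ hσ
  have hmem : Equiv.swap k (k + 1) ∈ closure S := hS ▸ subset_closure ⟨k, rfl⟩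
  have : Equiv.swap k (k + 1) k = k := hle hmem
  simp at this

theorem FreeGroup.exists_subgroup_not_fg : ∃ K : Subgroup (FreeGroup (Fin 2)), ¬ K.FG := by
  let f : FreeGroup (Fin 2) →* Equiv.Perm ℤ :=
    FreeGroup.lift ![Equiv.addRight (1 : ℤ), Equiv.swap 0 1]
  refine ⟨(closure (Set.range fun n : ℤ => Equiv.swap n (n + 1))).comap f, fun h => ?_⟩
  apply not_fg_closure_swap_add_one
  have hle : closure (Set.range fun n : ℤ => Equiv.swap n (n + 1)) ≤ f.range := by
    rw [closure_le]
    rintro _ ⟨n, rfl⟩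
    refine ⟨FreeGroup.of 0 ^ n * FreeGroup.of 1 * (FreeGroup.of 0 ^ n)⁻¹, ?_⟩
    have hf : f (FreeGroup.of 0) ^ n = Equiv.addRight n := by
      simp [f, Equiv.zsmul_addRight]
    rw [_root_.map_mul, _root_.map_mul, _root_.map_inv, _root_.map_zpow, hf]
    have h1 : f (FreeGroup.of 1) = Equiv.swap 0 1 := by simp [f]
    rw [h1, ← Equiv.swap_apply_apply]
    simp [add_comm]
  have := h.map_hom f
  rwa [map_comap_eq_self hle] at this

/-- For a group satisfying the Tits alternative, every subgroup is finitely
generated iff the group is virtually polycyclic. -/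
theorem stmt_16 {G : Type*} [Group G]
    (tits : ∀ H : Subgroup G, H.FG →
      (∃ φ : FreeGroup (Fin 2) →* ↥H, Function.Injective φ) ∨
      (∃ K : Subgroup ↥H, K.FiniteIndex ∧ IsSolvable ↥K)) :
    (∀ K : Subgroup G, K.FG) ↔
      ∃ H : Subgroup G, H.FiniteIndex ∧ IsPolycyclic ↥H := by
  constructor
  · intro hG
    obtain ⟨φ, hφ⟩ | ⟨K, hK, hsol⟩ := tits ⊤ (hG ⊤)
    · obtain ⟨K, hK⟩ := FreeGroup.exists_subgroup_not_fg
      have hinj : Function.Injective ((⊤ : Subgroup G).subtype.comp φ) :=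
        (subtype_injective _).comp hφ
      exact absurd (fg_of_fg_map_injective hinj (hG _)) hK
    · let e := K.equivMapOfInjective _ (⊤ : Subgroup G).subtype_injective
      refine ⟨K.map (⊤ : Subgroup G).subtype, ⟨?_⟩, ?_⟩
      · rw [index_map_subtype]
        simpa using hK.index_ne_zero
      · have : Group.IsSolvable K := hsol
        have : Group.IsSolvable (K.map (⊤ : Subgroup G).subtype) :=
          Group.isSolvable_of_surjective (f := e.toMonoidHom) e.surjective
        exact isPolycyclic_of_isSolvable fun L =>
          fg_of_fg_map_injective (subtype_injective _) (hG _)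
  · rintro ⟨H, hH, hpoly⟩
    refine fg_of_finiteIndex (H := H) fun K hK => ?_
    have := (hpoly.subgroup_fg (K.subgroupOf H)).map_hom H.subtype
    rwa [map_subgroupOf_eq_of_le hK] at this
end

section
/- Let G be a countable virtually solvable group, i.e., G has a solvable subgroup of finite index. Then every group shift on G is of finite type (for every finite group Σ, every subset X ⊆ (G → Σ) that is closed in the product topology, shift-invariant, and a subgroup under pointwise operations is of finite type) if and only if G is virtually polycyclic. -/
/-- The product topology on `G → A` where the alphabet `A` carries the discrete topology. -/
def prodTop (G A : Type*) : TopologicalSpace (G → A) :=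
  @Pi.topologicalSpace G (fun _ => A) (fun _ => ⊥)

/-- The shift action of a group `G` on `G → A`: `(g • x) h = x (g⁻¹ * h)`. -/
def shift {G : Type*} [Group G] {A : Type*} (g : G) (x : G → A) : G → A :=
  fun h => x (g⁻¹ * h)

/-- A subshift `X ⊆ A^G` is of finite type if there is a clopen set `C` such that
`x ∈ X` iff all shifts of `x` lie in `C`. -/
def IsSFT {G : Type*} [Group G] (A : Type*) (X : Set (G → A)) : Prop :=
  ∃ C : Set (G → A), @IsClopen _ (prodTop G A) C ∧ ∀ x, x ∈ X ↔ ∀ g : G, shift g x ∈ C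


section Cylinders

variable {G A : Type*}

lemma mem_of_forall_finset_exists_eqOn [TopologicalSpace A] [DiscreteTopology A]
    {X : Set (G → A)} (hX : IsClosed X) {x : G → A}
    (h : ∀ F : Finset G, ∃ y ∈ X, Set.EqOn x y F) : x ∈ X := by
  rw [← hX.closure_eq, mem_closure_iff]
  intro o ho hxo
  obtain ⟨F, u, hu, hsub⟩ := isOpen_pi_iff.1 ho x hxo
  obtain ⟨y, hy, hxy⟩ := h F
  exact ⟨y, hsub fun i hi => hxy hi ▸ (hu i hi).2, hy⟩

lemma isOpen_of_eqOn_finset [TopologicalSpace A] [DiscreteTopology A] {C : Set (G → A)}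
    (F : Finset G) (h : ∀ x ∈ C, ∀ y, Set.EqOn x y F → y ∈ C) : IsOpen C := by
  refine isOpen_pi_iff.2 fun x hx => ⟨F, fun i => {x i}, fun i _ => ⟨isOpen_discrete _, rfl⟩, ?_⟩
  exact fun y hy => h x hx y fun i hi => (hy i hi).symm

lemma isClopen_of_eqOn_finset [TopologicalSpace A] [DiscreteTopology A] {C : Set (G → A)}
    (F : Finset G) (h : ∀ x ∈ C, ∀ y, Set.EqOn x y F → y ∈ C) : IsClopen C :=
  ⟨⟨isOpen_of_eqOn_finset F fun x hx y hxy hy => hx (h y hy x hxy.symm)⟩,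
    isOpen_of_eqOn_finset F h⟩

lemma exists_finset_of_isClopen [TopologicalSpace A] [DiscreteTopology A] [Finite A]
    {C : Set (G → A)} (hC : IsClopen C) :
    ∃ F : Finset G, ∀ x ∈ C, ∀ y, Set.EqOn x y F → y ∈ C := by
  classical
  have hloc : ∀ x ∈ C, ∃ I : Finset G, ∀ y, Set.EqOn x y I → y ∈ C := by
    intro x hx
    obtain ⟨I, u, hu, hsub⟩ := isOpen_pi_iff.1 hC.isOpen x hx
    exact ⟨I, fun y hy => hsub fun i hi => hy hi ▸ (hu i hi).2⟩
  choose! I hI using hloc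
  obtain ⟨t, htC, ht⟩ := hC.isClosed.isCompact.elim_nhds_subcover
    (fun x => {y | Set.EqOn x y (I x)}) fun x _ =>
      (isOpen_of_eqOn_finset (I x) fun y hy z hyz => hy.trans hyz).mem_nhds (Set.eqOn_refl _ _)
  refine ⟨t.biUnion I, fun x hx y hxy => ?_⟩
  obtain ⟨z, hz, hzx⟩ := Set.mem_iUnion₂.1 (ht hx)
  exact hI z (htC z hz) y
    (hzx.trans (hxy.mono (Finset.coe_subset.2 (Finset.subset_biUnion_of_mem I hz))))

end Cylinders

lemma exists_forall_eq_of_antitone {α : Type*} [PartialOrder α] (L : ℕ → ℕ → α)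
    (hanti : ∀ ⦃n n' m m'⦄, n ≤ n' → m ≤ m' → L n' m' ≤ L n m)
    (hdiag : ∃ k, ∀ l, k ≤ l → L l l = L k k)
    (hrow : ∀ n, ∃ k, ∀ m, k ≤ m → L n m = L n k) :
    ∃ M, ∀ n m, M ≤ m → L n m = L n M := by
  obtain ⟨k, hk⟩ := hdiag
  choose r hr using hrow
  have hbig : ∀ n m, k ≤ n → k ≤ m → L n m = L k k := fun n m hn hm =>
    (hanti hn hm).antisymm
      ((hk (max n m) (hn.trans (le_max_left _ _))).symm.trans_le
        (hanti (le_max_left _ _) (le_max_right _ _)))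
  refine ⟨max k ((Finset.range k).sup r), fun n m hm => ?_⟩
  rcases le_or_gt k n with hn | hn
  · rw [hbig n m hn ((le_max_left _ _).trans hm), hbig n _ hn (le_max_left _ _)]
  · have hrn : r n ≤ max k ((Finset.range k).sup r) :=
      (Finset.le_sup (f := r) (Finset.mem_range.2 hn)).trans (le_max_right _ _)
    rw [hr n m (hrn.trans hm), hr n _ hrn]

section Shift

variable {G A : Type*} [Group G]

lemma shift_inv_shift (g : G) (x : G → A) : shift g⁻¹ (shift g x) = x := by
  funext h
  simp [shift]

lemma shift_shift_inv (g : G) (x : G → A) : shift g (shift g⁻¹ x) = x := by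
  funext h
  simp [shift]

end Shift

section GroupShifts

variable {G N A : Type*} [Group G] [Group N] [Group A]

/-- A closed shift-invariant subgroup of `G → A`. -/
structure IsGroupShift [TopologicalSpace A] (X : Subgroup (G → A)) : Prop where
  isClosed : IsClosed (X : Set (G → A))
  shift_mem : ∀ (g : G) (x : G → A), x ∈ X → shift g x ∈ X

variable (G A) in
/-- The descending chain condition for group shifts in `G → A`. -/
def GroupShiftDCC [TopologicalSpace A] : Prop :=
  ∀ X : ℕ → Subgroup (G → A), Antitone X → (∀ m, IsGroupShift (X m)) →
    ∃ m, ∀ n, m ≤ n → X n = X m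

/-- The subgroup of `N → A` obtained from those elements of `X` that are trivial on `W`, by reading
them along `a ↦ f a * c`. -/
def leadingSubgroup (f : N →* G) (c : G) (W : Set G) (X : Subgroup (G → A)) :
    Subgroup (N → A) where
  carrier := {u | ∃ x ∈ X, (∀ w ∈ W, x w = 1) ∧ ∀ a, u a = x (f a * c)}
  one_mem' := ⟨1, X.one_mem, fun _ _ => rfl, fun _ => rfl⟩
  mul_mem' := by
    rintro u v ⟨x, hx, hxW, hu⟩ ⟨y, hy, hyW, hv⟩
    exact ⟨x * y, X.mul_mem hx hy, fun w hw => by simp [hxW w hw, hyW w hw],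
      fun a => by simp [hu, hv]⟩
  inv_mem' := by
    rintro u ⟨x, hx, hxW, hu⟩
    exact ⟨x⁻¹, X.inv_mem hx, fun w hw => by simp [hxW w hw], fun a => by simp [hu]⟩

lemma leadingSubgroup_mono (f : N →* G) (c : G) {W W' : Set G} (hW : W' ⊆ W)
    {X Y : Subgroup (G → A)} (h : X ≤ Y) :
    leadingSubgroup f c W X ≤ leadingSubgroup f c W' Y := by
  rintro u ⟨x, hx, hxW, hu⟩
  exact ⟨x, h hx, fun w hw => hxW w (hW hw), hu⟩

lemma IsGroupShift.leadingSubgroup [TopologicalSpace A] [DiscreteTopology A] [Finite A]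
    {X : Subgroup (G → A)} (hX : IsGroupShift X) (f : N →* G) (c : G) {W : Set G}
    (hW : ∀ a, ∀ w ∈ W, f a * w ∈ W) : IsGroupShift (leadingSubgroup f c W X) where
  isClosed := by
    have hcl : IsClosed ((X : Set (G → A)) ∩ {x | ∀ w ∈ W, x w = 1}) := by
      refine hX.isClosed.inter ?_
      simp only [Set.ofPred_forall]
      exact isClosed_biInter fun w _ => isClosed_eq (continuous_apply w) continuous_const
    have hcont : Continuous fun (x : G → A) (a : N) => x (f a * c) := by fun_prop
    convert (hcl.isCompact.image hcont).isClosed using 1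
    ext u
    constructor
    · rintro ⟨x, hx, hxW, hu⟩
      exact ⟨x, ⟨hx, hxW⟩, (funext hu).symm⟩
    · rintro ⟨x, ⟨hx, hxW⟩, rfl⟩
      exact ⟨x, hx, hxW, fun _ => rfl⟩
  shift_mem := by
    rintro b u ⟨x, hx, hxW, hu⟩
    refine ⟨shift (f b) x, hX.shift_mem _ _ hx, fun w hw => ?_, fun a => ?_⟩
    · simpa [shift] using hxW _ (hW b⁻¹ w hw)
    · simp [shift, hu, mul_assoc]

lemma exists_eqOn_of_leadingSubgroup_le {f : N →* G} {c : G} {W : Set G}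
    {X Y : Subgroup (G → A)} (hYX : Y ≤ X)
    (h : leadingSubgroup f c W X ≤ leadingSubgroup f c W Y) {x y : G → A} (hx : x ∈ X)
    (hy : y ∈ Y) (hxy : Set.EqOn x y W) :
    ∃ z ∈ Y, Set.EqOn x z W ∧ ∀ a, x (f a * c) = z (f a * c) := by
  obtain ⟨z, hz, hzW, hu⟩ := h ⟨x * y⁻¹, X.mul_mem hx (X.inv_mem (hYX hy)),
    fun w hw => by simp [hxy hw], fun a => rfl⟩
  refine ⟨z * y, Y.mul_mem hz hy, fun w hw => by simp [hzW w hw, hxy hw], fun a => ?_⟩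
  simp [← hu a]

variable [TopologicalSpace A]

lemma GroupShiftDCC.of_finite [Finite A] [Finite G] : GroupShiftDCC G A := by
  intro X hX _
  obtain ⟨m, hm⟩ := WellFoundedGT.monotone_chain_condition
    (⟨fun n => OrderDual.toDual (X n), fun _ _ h => hX h⟩ : ℕ →o (Subgroup (G → A))ᵒᵈ)
  exact ⟨m, fun n hn => (hm n hn).symm⟩

variable [DiscreteTopology A]

/-- The descending chain condition forces group shifts to be of finite type. -/
lemma GroupShiftDCC.exists_isClopen [Countable G] (hG : GroupShiftDCC G A)
    {X : Subgroup (G → A)} (hX : IsGroupShift X) :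
    ∃ C : Set (G → A), IsClopen C ∧ ∀ x, x ∈ X ↔ ∀ g : G, shift g x ∈ C := by
  classical
  let C : Finset G → Set (G → A) := fun F => {x | ∃ y ∈ X, Set.EqOn x y F}
  have hC : ∀ F, IsClopen (C F) := fun F =>
    isClopen_of_eqOn_finset F fun x ⟨z, hz, hxz⟩ y hxy => ⟨z, hz, hxy.symm.trans hxz⟩
  let Y : Finset G → Subgroup (G → A) := fun F =>
    { carrier := {x | ∀ g, shift g x ∈ C F}
      one_mem' := fun g => ⟨1, X.one_mem, fun _ _ => rfl⟩
      mul_mem' := by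
        intro x x' hx hx' g
        obtain ⟨y, hy, hxy⟩ := hx g
        obtain ⟨y', hy', hxy'⟩ := hx' g
        exact ⟨y * y', X.mul_mem hy hy', fun h hh => congrArg₂ (· * ·) (hxy hh) (hxy' hh)⟩
      inv_mem' := by
        intro x hx g
        obtain ⟨y, hy, hxy⟩ := hx g
        exact ⟨y⁻¹, X.inv_mem hy, fun h hh => congrArg (·⁻¹) (hxy hh)⟩ }
  have hYs : ∀ F, IsGroupShift (Y F) := fun F =>
    { isClosed := by
        have : (Y F : Set (G → A)) = ⋂ g, shift g ⁻¹' C F := by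
          ext x
          simp [Y]
        rw [this]
        refine isClosed_iInter fun g => (hC F).isClosed.preimage ?_
        unfold shift
        fun_prop
      shift_mem := by
        intro g x hx g'
        have := hx (g' * g)
        convert this using 1
        funext h
        simp [shift, mul_assoc] }
  obtain ⟨e, he⟩ := exists_surjective_nat G
  let E : ℕ → Finset G := fun n => (Finset.range n).image e
  have hE : Monotone E := fun n n' h => Finset.image_subset_image (Finset.range_mono h)
  have hanti : Antitone (Y ∘ E) := by
    intro n n' h x hx g
    obtain ⟨y, hy, hxy⟩ := hx g
    exact ⟨y, hy, hxy.mono (Finset.coe_subset.2 (hE h))⟩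
  obtain ⟨m, hm⟩ := hG _ hanti fun n => hYs _
  refine ⟨C (E m), hC _, fun x => ⟨fun hx g => ⟨_, hX.shift_mem g x hx, Set.eqOn_refl _ _⟩,
    fun hx => mem_of_forall_finset_exists_eqOn hX.isClosed fun F => ?_⟩⟩
  choose r hr using he
  let n : ℕ := max m (F.sup fun g => r g + 1)
  have hxn : x ∈ Y (E n) := (hm n (le_max_left _ _)).ge hx
  obtain ⟨y, hy, hxy⟩ := hxn 1
  refine ⟨y, hy, fun g hg => ?_⟩
  have hgn : r g < n := (Nat.lt_succ_self _).trans_le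
    ((Finset.le_sup (f := fun g => r g + 1) hg).trans (le_max_right _ _))
  have hgE : g ∈ (E n : Set G) :=
    Finset.mem_coe.2 (Finset.mem_image.2 ⟨r g, Finset.mem_range.2 hgn, hr g⟩)
  simpa [shift] using hxy hgE

variable [Finite A]

/-- The descending chain condition passes from `N` to a group covered by finitely many right
translates of the image of `N`. -/
lemma GroupShiftDCC.of_finset (hN : GroupShiftDCC N A) (f : N →* G) (T : Finset G)
    (hT : ∀ g, ∃ a, ∃ c ∈ T, g = f a * c) : GroupShiftDCC G A := by
  classical
  intro X hX hXs
  have key : ∀ S : Finset G, ∃ M, ∀ m' m, M ≤ m' → m' ≤ m → ∀ x ∈ X m', ∃ y ∈ X m,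
      Set.EqOn x y {g | ∃ a, ∃ c ∈ S, g = f a * c} := by
    intro S
    induction S using Finset.induction_on with
    | empty => exact ⟨0, fun m' m _ _ x _ => ⟨1, (X m).one_mem, by simp [Set.EqOn]⟩⟩
    | insert c S _ ih =>
      obtain ⟨M₁, h₁⟩ := ih
      set W : Set G := {g | ∃ a, ∃ c ∈ S, g = f a * c}
      have hW : ∀ a, ∀ w ∈ W, f a * w ∈ W := by
        rintro a _ ⟨b, d, hd, rfl⟩
        exact ⟨a * b, d, hd, by simp [mul_assoc]⟩
      obtain ⟨M₂, h₂⟩ := hN (fun m => leadingSubgroup f c W (X m))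
        (fun m m' h => leadingSubgroup_mono f c subset_rfl (hX h))
        fun m => (hXs m).leadingSubgroup f c hW
      refine ⟨max M₁ M₂, fun m' m hm' hm x hx => ?_⟩
      obtain ⟨y, hy, hxy⟩ := h₁ m' m ((le_max_left _ _).trans hm') hm x hx
      have hle : leadingSubgroup f c W (X m') ≤ leadingSubgroup f c W (X m) :=
        ((h₂ m' ((le_max_right _ _).trans hm')).trans
          (h₂ m ((le_max_right _ _).trans (hm'.trans hm))).symm).le
      obtain ⟨z, hz, hxz, hc⟩ := exists_eqOn_of_leadingSubgroup_le (hX hm) hle hx hy hxy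
      refine ⟨z, hz, ?_⟩
      rintro _ ⟨a, d, hd, rfl⟩
      rcases Finset.mem_insert.1 hd with rfl | hd
      · exact hc a
      · exact hxz ⟨a, d, hd, rfl⟩
  obtain ⟨M, hM⟩ := key T
  refine ⟨M, fun m hm => (hX hm).antisymm fun x hx => ?_⟩
  obtain ⟨y, hy, hxy⟩ := hM M m le_rfl hm x hx
  have hxy : x = y := funext fun g => hxy (hT g)
  rwa [hxy]

/-- A noncommutative analogue of the Hilbert basis theorem: the descending chain condition passes
to extensions with cyclic quotient. -/
lemma GroupShiftDCC.of_zpow (hN : GroupShiftDCC N A) (f : N →* G) (t : G)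
    (hcover : ∀ g, ∃ a, ∃ k : ℤ, g = f a * t ^ k)
    (hnorm : ∀ a (k : ℤ), ∃ b, t ^ k * f a = f b * t ^ k) : GroupShiftDCC G A := by
  intro X hX hXs
  let W : ℕ → Set G := fun n => {g | ∃ a, ∃ i < n, g = f a * t ^ (i + 1)}
  have hW : ∀ n a, ∀ w ∈ W n, f a * w ∈ W n := by
    rintro n a _ ⟨b, i, hi, rfl⟩
    exact ⟨a * b, i, hi, by simp [mul_assoc]⟩
  have hWmono : Monotone W := by
    rintro n n' h _ ⟨b, i, hi, rfl⟩
    exact ⟨b, i, hi.trans_le h, rfl⟩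
  have hanti : ∀ ⦃n n' m m'⦄, n ≤ n' → m ≤ m' →
      leadingSubgroup f 1 (W n') (X m') ≤ leadingSubgroup f 1 (W n) (X m) :=
    fun n n' m m' hn hm => leadingSubgroup_mono f 1 (hWmono hn) (hX hm)
  obtain ⟨M, hM⟩ := exists_forall_eq_of_antitone
    (fun n m => leadingSubgroup f 1 (W n) (X m)) hanti
    (hN _ (fun _ _ h => hanti h h) fun m => (hXs m).leadingSubgroup f 1 (hW m))
    (fun n => hN _ (fun _ _ h => hanti le_rfl h) fun m => (hXs m).leadingSubgroup f 1 (hW n))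
  refine ⟨M, fun m hm => (hX hm).antisymm ?_⟩
  have key : ∀ n : ℕ, ∀ x ∈ X M, ∃ y ∈ X m, ∀ a, ∀ i < n, x (f a * t ^ i) = y (f a * t ^ i) := by
    intro n
    induction n with
    | zero => exact fun x _ => ⟨1, (X m).one_mem, by simp⟩
    | succ n ih =>
      intro x hx
      obtain ⟨y, hy, hxy⟩ := ih (shift t⁻¹ x) ((hXs M).shift_mem _ _ hx)
      have hEq : Set.EqOn x (shift t y) (W n) := by
        rintro _ ⟨a, i, hi, rfl⟩
        obtain ⟨b, hb⟩ := hnorm a (-1)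
        have hmul : t⁻¹ * (f a * t ^ (i + 1)) = f b * t ^ i := by
          rw [zpow_neg_one] at hb
          rw [← mul_assoc, hb, pow_succ']
          group
        rw [← shift_shift_inv t x]
        simp only [shift] at hxy ⊢
        rw [hmul]
        exact hxy b i hi
      obtain ⟨z, hz, hxz, h1⟩ := exists_eqOn_of_leadingSubgroup_le (hX hm) (hM n m hm).ge hx
        ((hXs m).shift_mem _ _ hy) hEq
      refine ⟨z, hz, fun a i hi => ?_⟩
      rcases i with _ | i
      · simpa using h1 a
      · exact hxz ⟨a, i, by omega, rfl⟩
  intro x hx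
  refine mem_of_forall_finset_exists_eqOn (hXs m).isClosed fun F => ?_
  choose a k hk using hcover
  let K : ℕ := F.sup fun g => (k g).natAbs
  obtain ⟨y, hy, hxy⟩ := key (2 * K + 1) (shift (t ^ K) x) ((hXs M).shift_mem _ _ hx)
  refine ⟨shift (t ^ K)⁻¹ y, (hXs m).shift_mem _ _ hy, fun g hg => ?_⟩
  have hgK : (k g).natAbs ≤ K := Finset.le_sup (f := fun g => (k g).natAbs) hg
  obtain ⟨b, hb⟩ := hnorm (a g) K
  have hmul : t ^ K * g = f b * t ^ (K + k g).toNat := by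
    rw [← zpow_natCast t (K + k g).toNat, Int.toNat_of_nonneg (by omega), zpow_add, ← mul_assoc,
      ← hb, mul_assoc, ← hk g, zpow_natCast]
  rw [← shift_inv_shift (t ^ K) x]
  simp only [shift, inv_inv] at hxy ⊢
  rw [hmul]
  exact hxy b _ (by omega)

lemma IsPolycyclic.groupShiftDCC (h : IsPolycyclic G) : GroupShiftDCC G A := by
  obtain ⟨n, s, h0, hlast, hstep⟩ := h
  have key : ∀ i, GroupShiftDCC (s i) A := by
    intro i
    induction i using Fin.induction with
    | zero =>
      rw [h0]
      exact GroupShiftDCC.of_finite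
    | succ i ih =>
      obtain ⟨hle, hn, hcyc⟩ := hstep i
      obtain ⟨q, hq⟩ := hcyc.exists_generator
      obtain ⟨t, rfl⟩ := QuotientGroup.mk_surjective q
      refine ih.of_zpow (Subgroup.inclusion hle) t (fun g => ?_) fun a k => ?_
      · obtain ⟨k, hk⟩ := hq (g : s i.succ ⧸ (s i.castSucc).subgroupOf (s i.succ))
        have hmem : g * (t ^ k)⁻¹ ∈ (s i.castSucc).subgroupOf (s i.succ) := by
          rw [← QuotientGroup.eq_one_iff]
          simp only [QuotientGroup.mk_mul, QuotientGroup.mk_inv, QuotientGroup.mk_zpow]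
          rw [← hk]
          simp
        refine ⟨⟨_, Subgroup.mem_subgroupOf.1 hmem⟩, k, Subtype.ext ?_⟩
        simp
      · have hmem := hn.conj_mem (Subgroup.inclusion hle a)
          (Subgroup.mem_subgroupOf.2 a.2) (t ^ k)
        refine ⟨⟨_, Subgroup.mem_subgroupOf.1 hmem⟩, Subtype.ext ?_⟩
        simp
  have htop := key (Fin.last n)
  exact htop.of_finset (s (Fin.last n)).subtype {1} fun g => ⟨⟨g, by simp [hlast]⟩, 1, by simp⟩

lemma GroupShiftDCC.of_finiteIndex {H : Subgroup G} [H.FiniteIndex] (hH : GroupShiftDCC H A) :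
    GroupShiftDCC G A := by
  classical
  have := Fintype.ofFinite (G ⧸ H)
  refine hH.of_finset H.subtype (Finset.univ.image fun q : G ⧸ H => q.out⁻¹) fun g => ?_
  obtain ⟨h, hh⟩ := QuotientGroup.mk_out_eq_mul H g⁻¹
  refine ⟨h, _, Finset.mem_image_of_mem _ (Finset.mem_univ (QuotientGroup.mk g⁻¹)), ?_⟩
  simp [hh]

end GroupShifts

section Polycyclic

variable {G : Type*} [Group G]

/-- If every group shift is of finite type, then every subgroup is finitely generated. -/
lemma Subgroup.fg_of_forall_isSFT
    (h : ∀ (A : Type) [Group A] [Finite A] (X : Set (G → A)),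
      @IsClosed _ (prodTop G A) X →
      (∀ (g : G) (x : G → A), x ∈ X → shift g x ∈ X) →
      (∃ S : Subgroup (G → A), ↑S = X) → IsSFT A X) (H : Subgroup G) : H.FG := by
  classical
  let A := Multiplicative (ZMod 2)
  let _ : TopologicalSpace A := ⊥
  have : DiscreteTopology A := ⟨rfl⟩
  let X : Subgroup (G → A) :=
    { carrier := {x | ∀ g, ∀ h ∈ H, x (g * h) = x g}
      one_mem' := fun _ _ _ => rfl
      mul_mem' := fun hx hy g h hh => congrArg₂ (· * ·) (hx g h hh) (hy g h hh)
      inv_mem' := fun hx g h hh => congrArg (·⁻¹) (hx g h hh) }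
  have hXcl : IsClosed (X : Set (G → A)) := by
    change IsClosed {x : G → A | ∀ g, ∀ h ∈ H, x (g * h) = x g}
    simp only [Set.ofPred_forall]
    exact isClosed_iInter fun g => isClosed_biInter fun h _ =>
      isClosed_eq (continuous_apply _) (continuous_apply _)
  obtain ⟨C, hC, hXC⟩ := h A X hXcl
    (fun g x hx k h hh => by simpa [shift, mul_assoc] using hx (g⁻¹ * k) h hh) ⟨X, rfl⟩
  obtain ⟨F, hF⟩ := exists_finset_of_isClopen (A := A) hC
  let D : Finset G := ((F ×ˢ F).image fun p => p.1⁻¹ * p.2).filter (· ∈ H)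
  have hDH : closure (D : Set G) ≤ H :=
    (closure_le H).2 fun d hd => (Finset.mem_filter.1 hd).2
  refine ⟨D, hDH.antisymm fun k hk => ?_⟩
  let a : A := Multiplicative.ofAdd 1
  have ha : a ≠ 1 := by decide
  let y : G → A := fun g => if g ∈ closure (D : Set G) then a else 1
  have hyX : y ∈ (X : Set (G → A)) := by
    refine (hXC y).2 fun g => ?_
    let x : G → A := fun p => if ∃ q ∈ F, q⁻¹ * p ∈ H ∧ g⁻¹ * q ∈ closure (D : Set G) then a else 1
    have hxX : x ∈ (X : Set (G → A)) := by
      intro p l hl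
      simp only [x, ← mul_assoc, H.mul_mem_cancel_right hl]
    have hxC := (hXC x).1 hxX 1
    refine hF _ hxC _ fun p hp => ?_
    have hiff : (∃ q ∈ F, q⁻¹ * p ∈ H ∧ g⁻¹ * q ∈ closure (D : Set G)) ↔
        g⁻¹ * p ∈ closure (D : Set G) := by
      constructor
      · rintro ⟨q, hq, hqp, hqD⟩
        have hmem : q⁻¹ * p ∈ closure (D : Set G) := subset_closure <| Finset.mem_coe.2 <|
          Finset.mem_filter.2 ⟨Finset.mem_image.2 ⟨(q, p), Finset.mk_mem_product hq hp, rfl⟩, hqp⟩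
        have := mul_mem hqD hmem
        rwa [mul_assoc, mul_inv_cancel_left] at this
      · exact fun hpD => ⟨p, hp, by simp, hpD⟩
    simp [shift, x, y, hiff]
  have := hyX 1 k hk
  by_contra hkD
  simp [y, hkD, ha.symm] at this

/-- `K` is normal in `L` with cyclic quotient. -/
def IsCyclicStep (K L : Subgroup G) : Prop :=
  K ≤ L ∧ ∃ hn : (K.subgroupOf L).Normal, letI := hn; IsCyclic (L ⧸ K.subgroupOf L)

lemma IsPolycyclic.of_reflTransGen
    (h : Relation.ReflTransGen IsCyclicStep (⊥ : Subgroup G) ⊤) : IsPolycyclic G := by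
  have key : ∀ L : Subgroup G, Relation.ReflTransGen IsCyclicStep ⊥ L →
      ∃ (n : ℕ) (s : Fin (n + 1) → Subgroup G), s 0 = ⊥ ∧ s (Fin.last n) = L ∧
        ∀ i : Fin n, IsCyclicStep (s i.castSucc) (s i.succ) := by
    intro L hL
    induction hL with
    | refl => exact ⟨0, fun _ => ⊥, rfl, rfl, fun i => i.elim0⟩
    | @tail K L _ hKL ih =>
      obtain ⟨n, s, h0, hl, hs⟩ := ih
      refine ⟨n + 1, Fin.snoc (α := fun _ => Subgroup G) s L, ?_, ?_, fun i => ?_⟩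
      · rw [← Fin.castSucc_zero, Fin.snoc_castSucc, h0]
      · rw [Fin.snoc_last]
      · rw [Fin.snoc_castSucc]
        induction i using Fin.lastCases with
        | last => rwa [Fin.succ_last, Fin.snoc_last, hl]
        | cast i =>
          rw [Fin.succ_castSucc, Fin.snoc_castSucc]
          exact hs i
  exact key ⊤ h

lemma isCyclicStep_sup_zpowers {B L : Subgroup G} {t : G} (hB : ⁅B, B⁆ ≤ L) (hL : L ≤ B)
    (ht : t ∈ B) : IsCyclicStep L (L ⊔ Subgroup.zpowers t) := by
  have hLt : L ⊔ Subgroup.zpowers t ≤ B := sup_le hL (by simpa using ht)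
  have hn : (L.subgroupOf (L ⊔ Subgroup.zpowers t)).Normal := by
    refine ⟨fun x hx y => ?_⟩
    rw [Subgroup.mem_subgroupOf] at hx ⊢
    have := mul_mem (hB (Subgroup.commutator_mem_commutator (hLt y.2) (hL hx))) hx
    simpa [commutatorElement_def] using this
  refine ⟨le_sup_left, hn, ?_⟩
  let t' : ↥(L ⊔ Subgroup.zpowers t) :=
    ⟨t, Subgroup.mem_sup_right (Subgroup.mem_zpowers t)⟩
  let M := (Subgroup.zpowers (QuotientGroup.mk' (L.subgroupOf (L ⊔ Subgroup.zpowers t)) t')).comap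
    (QuotientGroup.mk' _)
  have hM : L ⊔ Subgroup.zpowers t ≤ M.map (Subgroup.subtype _) := by
    refine sup_le (fun l hl => ⟨⟨l, Subgroup.mem_sup_left hl⟩, ?_, rfl⟩)
      (Subgroup.zpowers_le.2 ⟨t', ?_, rfl⟩)
    · have : QuotientGroup.mk' (L.subgroupOf (L ⊔ Subgroup.zpowers t))
          ⟨l, Subgroup.mem_sup_left hl⟩ = 1 :=
        (QuotientGroup.eq_one_iff _).2 (Subgroup.mem_subgroupOf.2 hl)
      change _ ∈ Subgroup.zpowers _
      rw [this]
      exact one_mem _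
    · exact Subgroup.mem_zpowers _
  refine ⟨QuotientGroup.mk' _ t', fun q => ?_⟩
  obtain ⟨g, rfl⟩ := QuotientGroup.mk_surjective q
  obtain ⟨g', hg', hgg'⟩ := hM g.2
  rwa [Subtype.ext hgg'] at hg'

lemma reflTransGen_isCyclicStep_of_fg {B L : Subgroup G} (hB : ⁅B, B⁆ ≤ L) (hL : L ≤ B)
    (hfg : B.FG) : Relation.ReflTransGen IsCyclicStep L B := by
  classical
  obtain ⟨T, hT⟩ := hfg
  have key : ∀ S : Finset G, (∀ g ∈ S, g ∈ B) →
      Relation.ReflTransGen IsCyclicStep L (L ⊔ Subgroup.closure (S : Set G)) := by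
    intro S
    induction S using Finset.induction_on with
    | empty => simp [Relation.ReflTransGen.refl]
    | insert t S _ ih =>
      intro hS
      have hS' : ∀ g ∈ S, g ∈ B := fun g hg => hS g (Finset.mem_insert_of_mem hg)
      have heq : L ⊔ Subgroup.closure ((insert t S : Finset G) : Set G) =
          L ⊔ Subgroup.closure (S : Set G) ⊔ Subgroup.zpowers t := by
        rw [Finset.coe_insert, Set.insert_eq, Subgroup.closure_union,
          ← Subgroup.zpowers_eq_closure, sup_comm (Subgroup.zpowers t), sup_assoc]
      rw [heq]
      exact (ih hS').tail (isCyclicStep_sup_zpowers (hB.trans le_sup_left)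
        (sup_le hL ((Subgroup.closure_le B).2 hS')) (hS t (Finset.mem_insert_self _ _)))
  have := key T fun g hg => hT ▸ Subgroup.subset_closure hg
  rwa [hT, sup_eq_right.2 hL] at this

lemma IsPolycyclic.of_isSolvable [Group.IsSolvable G] (hfg : ∀ H : Subgroup G, H.FG) :
    IsPolycyclic G := by
  obtain ⟨n, hn⟩ := Group.IsSolvable.solvable (G := G)
  refine .of_reflTransGen (hn ▸ ?_)
  clear hn
  induction n with
  | zero => rw [derivedSeries_zero]
  | succ n ih =>
    refine .trans (reflTransGen_isCyclicStep_of_fg ?_ ?_ (hfg _)) ih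
    · rw [derivedSeries_succ]
    · exact derivedSeries_antitone G n.le_succ

end Polycyclic

/-- For a countable virtually solvable group, all group shifts are of finite type
iff the group is virtually polycyclic. -/
theorem stmt_18 {G : Type*} [Group G] [Countable G]
    (hvs : ∃ H : Subgroup G, H.FiniteIndex ∧ IsSolvable ↥H) :
    (∀ (A : Type) [Group A] [Finite A] (X : Set (G → A)),
        @IsClosed _ (prodTop G A) X →
        (∀ (g : G) (x : G → A), x ∈ X → shift g x ∈ X) →
        (∃ S : Subgroup (G → A), ↑S = X) →
        IsSFT A X) ↔
      ∃ H : Subgroup G, H.FiniteIndex ∧ IsPolycyclic ↥H := by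
  constructor
  · intro h
    obtain ⟨H, hH, hs⟩ := hvs
    have : Group.IsSolvable H := hs
    refine ⟨H, hH, .of_isSolvable fun K => ?_⟩
    have hK := Subgroup.fg_of_forall_isSFT h (K.map H.subtype)
    rw [Subgroup.fg_iff_submonoid_fg] at hK ⊢
    exact hK.map_injective H.subtype H.subtype_injective
  · rintro ⟨H, hH, hp⟩ A _ _ _ hcl hinv ⟨X, rfl⟩
    let _ : TopologicalSpace A := ⊥
    have : DiscreteTopology A := ⟨rfl⟩
    exact (GroupShiftDCC.of_finiteIndex hp.groupShiftDCC).exists_isClopen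
      (X := X) ⟨hcl, hinv⟩
end
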